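/- Let LRS be the category of locally ringed spaces and let i : Z → X be a morphism of locally ringed spaces. Then the open subspace X \ Z (the set-theoretic complement of the image of Z, with restricted structure sheaf O_X|_{X∖Z}) together with its inclusion into X is a complement of i: any morphism of locally ringed spaces X' → X whose pullback with Z is empty factors uniquely through X ∖ Z → X. -/

import Mathlib

open CategoryTheory Limits AlgebraicGeometry

universe v u

/-- Maps `i : Z ⟶ X` and `j : U ⟶ X` are *disjoint* if every commutative square
over them has initial top-left vertex. -/
def AreDisjoint {C : Type u} [Category.{v} C] {Z X U : C} (i : Z ⟶ X) (j : U ⟶ X) : Prop :=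
  ∀ (A : C) (a : A ⟶ Z) (b : A ⟶ U), a ≫ i = b ≫ j → Nonempty (IsInitial A)

theorem exists_field_of_local {R A B : Type u} [CommRing R] [CommRing A] [CommRing B]
    [IsLocalRing R] [IsLocalRing A] [IsLocalRing B] (f : R →+* A) (g : R →+* B)
    [IsLocalHom f] [IsLocalHom g] :
    ∃ (K : Type u) (_ : Field K) (a : A →+* K) (b : B →+* K),
      IsLocalHom a ∧ IsLocalHom b ∧ a.comp f = b.comp g := by
  let k := IsLocalRing.ResidueField R
  let kA := IsLocalRing.ResidueField A
  let kB := IsLocalRing.ResidueField B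
  let : Algebra k kA := (IsLocalRing.ResidueField.map f).toAlgebra
  let : Algebra k kB := (IsLocalRing.ResidueField.map g).toAlgebra
  let T := TensorProduct k kA kB
  obtain ⟨m, hm⟩ := Ideal.exists_maximal T
  let : Field (T ⧸ m) := Ideal.Quotient.field m
  let a' : kA →+* T ⧸ m := (Ideal.Quotient.mk m).comp
    (Algebra.TensorProduct.includeLeft : kA →ₐ[k] T).toRingHom
  let b' : kB →+* T ⧸ m := (Ideal.Quotient.mk m).comp
    (Algebra.TensorProduct.includeRight : kB →ₐ[k] T).toRingHom
  have hab : a'.comp (IsLocalRing.ResidueField.map f) =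
      b'.comp (IsLocalRing.ResidueField.map g) := by
    ext x
    have h1 := (Algebra.TensorProduct.includeLeft : kA →ₐ[k] T).commutes x
    have h2 := (Algebra.TensorProduct.includeRight : kB →ₐ[k] T).commutes x
    exact congrArg (Ideal.Quotient.mk m) (h1.trans h2.symm)
  refine ⟨T ⧸ m, inferInstance, a'.comp (IsLocalRing.residue A), b'.comp (IsLocalRing.residue B),
    inferInstance, inferInstance, ?_⟩
  ext x
  exact RingHom.congr_fun hab (IsLocalRing.residue R x)

open TopCat Opposite TopologicalSpace

theorem emptyInitial (A : LocallyRingedSpace.{u}) (h : IsEmpty A) :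
    Nonempty (IsInitial A) := by
  have hT : ∀ U : (Opens A.toTopCat)ᵒᵖ, Nonempty (IsTerminal (A.presheaf.obj U)) := by
    intro U
    have : U = op ⊥ := by
      apply Opposite.unop_injective
      ext x; exact h.elim x
    subst this
    exact ⟨TopCat.Sheaf.isTerminalOfEmpty A.sheaf⟩
  refine ⟨IsInitial.ofUniqueHom (fun Y ↦ ⟨⟨TopCat.ofHom ⟨fun x ↦ h.elim x, ?_⟩,
    { app := fun U ↦ (hT _).some.from _, naturality := ?_ }⟩, ?_⟩) ?_⟩
  · exact continuous_iff_continuousAt.2 fun x ↦ h.elim x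
  · intro U V f
    exact (hT _).some.hom_ext _ _
  · intro x
    exact h.elim x
  · intro Y m
    apply LocallyRingedSpace.Hom.ext'
    refine PresheafedSpace.Hom.ext _ _ ?_ ?_
    · ext x; exact h.elim x
    · apply NatTrans.ext
      funext U
      exact (hT _).some.hom_ext _ _

theorem exists_sheafify {S : TopCat.{u}} (P : S.Presheaf CommRingCat.{u}) :
    ∃ (G : S.Presheaf CommRingCat.{u}) (_ : G.IsSheaf) (t : P ⟶ G),
      (∀ x : S, IsIso ((Presheaf.stalkFunctor CommRingCat x).map t)) ∧
      ∀ H : S.Presheaf CommRingCat.{u}, H.IsSheaf → ∀ α : P ⟶ H, ∃! β : G ⟶ H, t ≫ β = α :=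
  let J := Opens.grothendieckTopology S
  ⟨sheafify J P, ((presheafToSheaf J CommRingCat).obj P).2, toSheafify J P,
    fun x ↦ Presheaf.stalkFunctor_map_unit_toSheafify_isIso x CommRingCat P,
    fun H hH α ↦ ⟨sheafifyLift J α hH, toSheafify_sheafifyLift J α hH,
      fun β hβ ↦ sheafifyLift_unique J α hH β hβ⟩⟩

theorem stalkPushforward_nat {S X : TopCat.{u}} (f : S ⟶ X) {P G : S.Presheaf CommRingCat.{u}}
    (t : P ⟶ G) (x : S) :
    (Presheaf.stalkFunctor CommRingCat (f x)).map ((Presheaf.pushforward CommRingCat f).map t) ≫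
      G.stalkPushforward CommRingCat f x =
    P.stalkPushforward CommRingCat f x ≫ (Presheaf.stalkFunctor CommRingCat x).map t := by
  refine Presheaf.stalk_hom_ext _ fun U hU ↦ ?_
  erw [Presheaf.stalkFunctor_map_germ_assoc, Presheaf.stalkPushforward_germ_assoc,
    Presheaf.stalkFunctor_map_germ, Presheaf.stalkPushforward_germ]
  rfl

theorem exists_inverse_image {S X : TopCat.{u}} (f : S ⟶ X) (F : X.Presheaf CommRingCat.{u}) :
    ∃ (G : S.Presheaf CommRingCat.{u}) (_ : G.IsSheaf) (η : F ⟶ f _* G),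
      (∀ x : S, IsIso ((Presheaf.stalkFunctor CommRingCat (f x)).map η ≫
        G.stalkPushforward CommRingCat f x)) ∧
      ∀ H : S.Presheaf CommRingCat.{u}, H.IsSheaf → ∀ α : F ⟶ f _* H,
        ∃! β : G ⟶ H, η ≫ (Presheaf.pushforward CommRingCat f).map β = α := by
  obtain ⟨G, hG, t, ht, hu⟩ := exists_sheafify ((Presheaf.pullback CommRingCat f).obj F)
  let adj := Presheaf.pullbackPushforwardAdjunction CommRingCat.{u} f
  refine ⟨G, hG, adj.unit.app F ≫ (Presheaf.pushforward CommRingCat f).map t, ?_, ?_⟩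
  · intro x
    have h1 := ht x
    have h2 : IsIso (Presheaf.stalkPullbackHom CommRingCat f F x) :=
      (Presheaf.stalkPullbackIso CommRingCat f F x).isIso_hom
    have : (Presheaf.stalkFunctor CommRingCat (f x)).map (adj.unit.app F ≫
        (Presheaf.pushforward CommRingCat f).map t) ≫ G.stalkPushforward CommRingCat f x =
        Presheaf.stalkPullbackHom CommRingCat f F x ≫
          (Presheaf.stalkFunctor CommRingCat x).map t := by
      rw [Functor.map_comp]
      exact (Category.assoc _ _ _).trans <| (congrArg (fun y ↦ (Presheaf.stalkFunctor CommRingCat (f x)).map (adj.unit.app F) ≫ y)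
        (stalkPushforward_nat f t x)).trans (Category.assoc _ _ _).symm
    rw [this]
    exact IsIso.comp_isIso' h2 h1
  · intro H hH α
    obtain ⟨β, hβ, hβu⟩ := hu H hH ((adj.homEquiv F H).symm α)
    refine ⟨β, ?_, ?_⟩
    · dsimp only at hβ ⊢
      rw [Category.assoc, ← Functor.map_comp, hβ, ← adj.homEquiv_unit]
      exact (adj.homEquiv F H).apply_symm_apply α
    · intro β' hβ'
      apply hβu
      rw [Equiv.eq_symm_apply, adj.homEquiv_unit, Functor.map_comp, ← Category.assoc]
      exact hβ'

theorem exists_subspace (X : LocallyRingedSpace.{u}) (S : Set X) :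
    ∃ (U : LocallyRingedSpace.{u}) (j : U ⟶ X),
      Topology.IsEmbedding j.base ∧
      Set.range j.base = S ∧
      (∀ u : U, IsIso (j.stalkMap u)) ∧
      ∀ (X' : LocallyRingedSpace.{u}) (v : X' ⟶ X),
        Set.range v.base ⊆ S → ∃! k : X' ⟶ U, k ≫ j = v := by
  let T : TopCat.{u} := TopCat.of S
  let f : T ⟶ X.toTopCat := TopCat.ofHom ⟨Subtype.val, continuous_subtype_val⟩
  obtain ⟨G, hG, η, hiso, huniv⟩ := exists_inverse_image f X.presheaf
  let U : LocallyRingedSpace.{u} :=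
    { carrier := T
      presheaf := G
      IsSheaf := hG
      isLocalRing := fun x ↦ by
        have := hiso x
        exact @RingEquiv.isLocalRing _ _ _ (X.isLocalRing (f x)) _
          (asIso ((Presheaf.stalkFunctor CommRingCat (f x)).map η ≫
            G.stalkPushforward CommRingCat f x)).commRingCatIsoToRingEquiv }
  let j' : U.toPresheafedSpace ⟶ X.toPresheafedSpace := PresheafedSpace.Hom.mk f η
  have hst : ∀ x : U, IsIso (j'.stalkMap x) := hiso
  let j : U ⟶ X := ⟨j', fun x ↦ by have := hst x; infer_instance⟩
  refine ⟨U, j, Topology.IsEmbedding.subtypeVal, Subtype.range_coe, hst, ?_⟩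
  rintro X' ⟨⟨b, c⟩, hv⟩ hr
  obtain ⟨k0, hk0⟩ : ∃ k0 : X'.toTopCat ⟶ T, k0 ≫ f = b := ⟨TopCat.ofHom
    ⟨fun x ↦ ⟨b x, hr ⟨x, rfl⟩⟩, Continuous.subtype_mk b.hom.continuous _⟩, rfl⟩
  subst hk0
  obtain ⟨β, hβ, hβu⟩ := huniv (k0 _* X'.presheaf)
    (TopCat.Sheaf.pushforward_sheaf_of_sheaf k0 X'.IsSheaf) c
  let k' : X'.toPresheafedSpace ⟶ U.toPresheafedSpace := PresheafedSpace.Hom.mk k0 β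
  let v' : X'.toPresheafedSpace ⟶ X.toPresheafedSpace := PresheafedSpace.Hom.mk (k0 ≫ f) c
  have hk' : k' ≫ j' = v' := by
    refine PresheafedSpace.hext _ _ rfl (heq_of_eq ?_)
    exact hβ
  refine ⟨⟨k', ?_⟩, ?_, ?_⟩
  · intro x
    have h1 : IsLocalHom (v'.stalkMap x).hom := hv x
    have h2 : (k' ≫ j').stalkMap x = j'.stalkMap (k0 x) ≫ k'.stalkMap x :=
      PresheafedSpace.stalkMap.comp k' j' x
    have h3 : IsLocalHom ((k' ≫ j').stalkMap x).hom := by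
      have : ∀ w : X'.toPresheafedSpace ⟶ X.toPresheafedSpace, w = v' →
        IsLocalHom (w.stalkMap x).hom := by rintro w rfl; exact h1
      exact this _ hk'
    rw [h2] at h3
    have h4 := hst (k0 x)
    refine ⟨fun a ha ↦ ?_⟩
    obtain ⟨r, rfl⟩ : ∃ r, (j'.stalkMap (k0 x)).hom r = a :=
      ⟨(inv (j'.stalkMap (k0 x))).hom a, by
        rw [← RingHom.comp_apply, ← CommRingCat.hom_comp, IsIso.inv_hom_id]; rfl⟩
    exact IsUnit.map _ (h3.map_nonunit r ha)
  · apply LocallyRingedSpace.Hom.ext'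
    exact hk'
  · rintro ⟨⟨k1, γ⟩, hk⟩ hkj
    have hb : k1 = k0 := by
      have h1 : k1 ≫ f = k0 ≫ f := congrArg (fun m : X' ⟶ X ↦ m.base) hkj
      ext x
      exact congrArg (fun m : X'.toTopCat ⟶ X.toTopCat ↦ m x) h1
    subst hb
    have hγ : γ = β := by
      apply hβu
      have h1 := congrArg LocallyRingedSpace.Hom.toHom hkj
      injection h1 with h1 h2
    subst hγ
    rfl

open scoped Classical in
/-- The one-point locally ringed space with a field as ring of functions. -/
noncomputable def ptSpace (K : Type u) [Field K] : LocallyRingedSpace.{u} where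
  carrier := TopCat.of PUnit.{u + 1}
  presheaf := skyscraperPresheaf (X := TopCat.of PUnit.{u + 1}) PUnit.unit (CommRingCat.of K)
  IsSheaf := skyscraperPresheaf_isSheaf _ _
  isLocalRing x := by
    have e := skyscraperPresheafStalkOfSpecializes (X := TopCat.of PUnit.{u + 1}) PUnit.unit
      (CommRingCat.of K) (y := x) (specializes_rfl)
    have : IsLocalRing (CommRingCat.of K) := inferInstanceAs (IsLocalRing K)
    exact RingEquiv.isLocalRing e.symm.commRingCatIsoToRingEquiv

open scoped Classical in
/-- The map of presheafed spaces from a point. -/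
noncomputable def ptHom (K : Type u) [Field K] (X : LocallyRingedSpace.{u}) (x : X)
    (φ : X.presheaf.stalk x ⟶ CommRingCat.of K) :
    (ptSpace K).toPresheafedSpace ⟶ X.toPresheafedSpace :=
  PresheafedSpace.Hom.mk (TopCat.ofHom (ContinuousMap.const _ x))
    (@StalkSkyscraperPresheafAdjunctionAuxs.toSkyscraperPresheaf X.toTopCat x
      (fun U ↦ Classical.propDecidable _) CommRingCat _ _ _ X.presheaf (CommRingCat.of K) φ)

theorem ptHom_app (K : Type u) [Field K] (X : LocallyRingedSpace.{u}) (x : X)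
    (φ : X.presheaf.stalk x ⟶ CommRingCat.of K) (U : Opens X.toTopCat) (hU : x ∈ U)
    (h : CommRingCat.of K = (ptSpace K).presheaf.obj
      (op ((Opens.map (ptHom K X x φ).base).obj U))) :
    (ptHom K X x φ).c.app (op U) = X.presheaf.germ U x hU ≫ φ ≫ eqToHom h :=
  dif_pos hU

theorem ptHom_obj (K : Type u) [Field K] (V : Opens (TopCat.of PUnit.{u + 1}))
    (hV : PUnit.unit ∈ V) :
    CommRingCat.of K = (ptSpace K).presheaf.obj (op V) := (if_pos hV).symm

theorem ptHom_terminal (K : Type u) [Field K] (V : Opens (TopCat.of PUnit.{u + 1}))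
    (hV : PUnit.unit ∉ V) :
    Nonempty (IsTerminal ((ptSpace K).presheaf.obj (op V))) :=
  ⟨(if_neg hV).symm.ndrec terminalIsTerminal⟩

theorem pt_germ (K : Type u) [Field K] (y : ptSpace K) (V : Opens (ptSpace K).toTopCat)
    (hV : y ∈ V) :
    eqToHom (ptHom_obj K V hV) ≫ (ptSpace K).presheaf.germ V y hV =
      eqToHom (ptHom_obj K ⊤ trivial) ≫ (ptSpace K).presheaf.germ ⊤ y trivial := by
  obtain rfl : V = ⊤ := by
    ext z; exact ⟨fun _ ↦ trivial, fun _ ↦ hV⟩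
  rfl

/-- The map of locally ringed spaces from a point. -/
noncomputable def ptTo (K : Type u) [Field K] (X : LocallyRingedSpace.{u}) (x : X)
    (φ : X.presheaf.stalk x ⟶ CommRingCat.of K) (hφ : IsLocalHom φ.hom) : ptSpace K ⟶ X :=
  ⟨ptHom K X x φ, fun y ↦ by
    have e : (ptHom K X x φ).stalkMap y = φ ≫
        eqToHom (ptHom_obj K ⊤ trivial) ≫ (ptSpace K).presheaf.germ ⊤ y trivial := by
      refine Presheaf.stalk_hom_ext _ fun U hU ↦ ?_
      refine (PresheafedSpace.stalkMap_germ (ptHom K X x φ) U y hU).trans ?_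
      rw [ptHom_app K X x φ U hU (ptHom_obj K _ hU)]
      rw [Category.assoc, Category.assoc]
      exact congrArg (fun w ↦ X.presheaf.germ U x hU ≫ φ ≫ w) (pt_germ K y _ hU)
    rw [e]
    have : IsLocalHom (eqToHom (ptHom_obj K ⊤ trivial) ≫
      (ptSpace K).presheaf.germ ⊤ y trivial).hom := by
      refine ⟨fun a ha ↦ ?_⟩
      have : a ≠ (0 : K) := by
        rintro rfl
        rw [map_zero] at ha
        have := (ptSpace K).isLocalRing y
        exact not_isUnit_zero ha
      exact (isUnit_iff_ne_zero (G₀ := K)).2 this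
    exact @RingHom.isLocalHom_comp _ _ _ _ _ _ _ _ this hφ⟩

theorem ptTo_comp (K : Type u) [Field K] {Z X : LocallyRingedSpace.{u}} (f : Z ⟶ X) (z : Z)
    (φ : Z.presheaf.stalk z ⟶ CommRingCat.of K) (hφ : IsLocalHom φ.hom)
    (hφ' : IsLocalHom (f.stalkMap z ≫ φ).hom) :
    ptTo K Z z φ hφ ≫ f = ptTo K X (f.base z) (f.stalkMap z ≫ φ) hφ' := by
  apply LocallyRingedSpace.Hom.ext'
  refine PresheafedSpace.hext _ _ rfl (heq_of_eq ?_)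
  apply NatTrans.ext
  funext ⟨U⟩
  by_cases hU : f.base z ∈ U
  · refine Eq.trans ?_ (ptHom_app K X (f.base z) (f.stalkMap z ≫ φ) U hU (ptHom_obj K _ hU)).symm
    refine (congrArg (fun y ↦ f.c.app (op U) ≫ y)
      (ptHom_app K Z z φ ((Opens.map f.base).obj U) hU (ptHom_obj K _ hU))).trans ?_
    have := PresheafedSpace.stalkMap_germ f.toHom U z hU
    have := congrArg (fun y ↦ y ≫ φ ≫ eqToHom
      (ptHom_obj K ((Opens.map (ptHom K Z z φ).base).obj ((Opens.map f.base).obj U)) hU)) this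
    simp only [Category.assoc] at this ⊢
    exact this.symm
  · exact (ptHom_terminal K _ hU).some.hom_ext _ _

theorem exists_common_point {Z Y X : LocallyRingedSpace.{u}} (f : Z ⟶ X) (g : Y ⟶ X) (z : Z) (y : Y)
    (h : f.base z = g.base y) :
    ∃ (A : LocallyRingedSpace.{u}) (_ : Nonempty A) (a : A ⟶ Z) (b : A ⟶ Y), a ≫ f = b ≫ g := by
  have key : ∀ (x x' : X) (hx : x = x') (s : X.presheaf.stalk x ⟶ Z.presheaf.stalk z)
      (t : X.presheaf.stalk x' ⟶ Y.presheaf.stalk y), IsLocalHom s.hom → IsLocalHom t.hom →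
      ∃ (K : Type u) (_ : Field K) (φ : Z.presheaf.stalk z ⟶ CommRingCat.of K)
        (ψ : Y.presheaf.stalk y ⟶ CommRingCat.of K) (h1 : IsLocalHom φ.hom)
        (h2 : IsLocalHom ψ.hom) (h3 : IsLocalHom (s ≫ φ).hom) (h4 : IsLocalHom (t ≫ ψ).hom),
        ptTo K X x (s ≫ φ) h3 = ptTo K X x' (t ≫ ψ) h4 := by
    rintro x _ rfl s t hs ht
    obtain ⟨K, _, a, b, ha, hb, hab⟩ := exists_field_of_local s.hom t.hom
    have e : s ≫ CommRingCat.ofHom a = t ≫ CommRingCat.ofHom b := by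
      ext1; exact hab
    refine ⟨K, inferInstance, CommRingCat.ofHom a, CommRingCat.ofHom b, ha, hb,
      RingHom.isLocalHom_comp a s.hom, RingHom.isLocalHom_comp b t.hom, ?_⟩
    congr 1
  obtain ⟨K, _, φ, ψ, h1, h2, h3, h4, e⟩ := key _ _ h (f.stalkMap z) (g.stalkMap y)
    (f.prop z) (g.prop y)
  exact ⟨ptSpace K, ⟨PUnit.unit⟩, ptTo K Z z φ h1, ptTo K Y y ψ h2,
    (ptTo_comp K f z φ h1 h3).trans (e.trans (ptTo_comp K g y ψ h2 h4).symm)⟩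

theorem not_isInitial_of_nonempty (A : LocallyRingedSpace.{u}) (hA : Nonempty A) :
    IsEmpty (IsInitial A) :=
  ⟨fun h ↦ (h.to (∅ : LocallyRingedSpace.{u})).base hA.some |>.elim⟩

/-- Every morphism of locally ringed spaces `i : Z ⟶ X` admits a complement, given by the
locally ringed space `X ∖ Z` whose underlying topological space is the set-theoretic
complement of the image of `Z` (with the subspace topology) and whose structure sheaf is
the restriction of `O_X`: there is a monomorphism `j : U ⟶ X` inducing an embedding of
topological spaces with image exactly `(range i.base)ᶜ`, with stalk maps isomorphisms
(so the structure sheaf of `U` is `O_X` restricted), such that `j` is disjoint from `i`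
and every morphism `X' ⟶ X` of locally ringed spaces disjoint from `i` factors uniquely
through `j`. -/
theorem locallyRingedSpace_complement
    (Z X : LocallyRingedSpace.{u}) (i : Z ⟶ X) :
    ∃ (U : LocallyRingedSpace.{u}) (j : U ⟶ X),
      Mono j ∧
      Topology.IsEmbedding j.base ∧
      Set.range j.base = (Set.range i.base)ᶜ ∧
      (∀ u : U, IsIso (j.stalkMap u)) ∧
      AreDisjoint i j ∧
      ∀ (X' : LocallyRingedSpace.{u}) (v : X' ⟶ X),
        AreDisjoint i v → ∃! k : X' ⟶ U, k ≫ j = v := by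
  obtain ⟨U, j, hemb, hrange, hst, huniv⟩ := exists_subspace X (Set.range i.base)ᶜ
  refine ⟨U, j, ⟨fun {W} g h e ↦ ?_⟩, hemb, hrange, hst, ?_, ?_⟩
  · refine (huniv W (h ≫ j) ?_).unique e rfl
    rintro _ ⟨w, rfl⟩
    rw [← hrange]
    exact ⟨h.base w, rfl⟩
  · intro A a b e
    refine emptyInitial A ⟨fun x ↦ ?_⟩
    have h1 : j.base (b.base x) ∈ (Set.range i.base)ᶜ := hrange ▸ ⟨b.base x, rfl⟩
    exact h1 ⟨a.base x, congrArg (fun m : A ⟶ X ↦ m.base x) e⟩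
  · intro X' v hv
    refine huniv X' v ?_
    rintro _ ⟨y, rfl⟩ ⟨z, hz⟩
    obtain ⟨A, hA, a, b, e⟩ := exists_common_point i v z y hz
    exact (not_isInitial_of_nonempty A hA).false (hv A a b e).some
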